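/- For every integer n ≥ 3, every real c > 0 and every x > 0, the identity (α(x) + n·c)·x·α'(x) = 2c·x + α(x)² − n·c·α(x) holds. -/

import Mathlib

open Real Filter

noncomputable def alphaF (n : ℕ) (c : ℝ) (x : ℝ) : ℝ :=
  (n : ℝ) * c + ((n : ℝ) / (2 * ((n : ℝ) - 1))) * x
    - (((n : ℝ) - 2) / (2 * ((n : ℝ) - 1))) * Real.sqrt (x ^ 2 + 4 * ((n : ℝ) - 1) * c * x)

noncomputable def yn (n : ℕ) : ℝ :=
  4 * (1 - (n : ℝ)) + (2 * ((n : ℝ) ^ 2 - 4) / Real.sqrt (2 * (n : ℝ) - 5)) *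
    Real.cos ((1 / 3) * Real.arctan (((n : ℝ) ^ 2 - 4 * (n : ℝ) + 6) /
      (2 * ((n : ℝ) - 1) * Real.sqrt (2 * (n : ℝ) - 5))))

noncomputable def x0 (n : ℕ) (c : ℝ) : ℝ := yn n * c

noncomputable def betaF (n : ℕ) (c : ℝ) (x : ℝ) : ℝ :=
  alphaF n c (x0 n c) + deriv (alphaF n c) (x0 n c) * (x - x0 n c)
    + (1 / 2) * deriv (deriv (alphaF n c)) (x0 n c) * (x - x0 n c) ^ 2

noncomputable def gammaF (n : ℕ) (c : ℝ) (x : ℝ) : ℝ :=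
  if x0 n c ≤ x then alphaF n c x else betaF n c x

noncomputable def gammaF' (n : ℕ) (c : ℝ) (x : ℝ) : ℝ :=
  derivWithin (gammaF n c) (Set.Ici 0) x

noncomputable def gammaF'' (n : ℕ) (c : ℝ) (x : ℝ) : ℝ :=
  derivWithin (gammaF' n c) (Set.Ici 0) x

noncomputable def omegaF (n : ℕ) (c : ℝ) (x : ℝ) : ℝ :=
  (x ^ 2 / Real.sqrt (x ^ 2 + 4 * ((n : ℝ) - 1) * c * x)) *
    ((1 + (n : ℝ) ^ 2 * c / x) *
      (((n : ℝ) / ((n : ℝ) - 2) - (1 + 4 * ((n : ℝ) - 1) * c / x) ^ (-(1 / 2) : ℝ)) /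
       ((n : ℝ) / ((n : ℝ) - 2) + (1 + 4 * ((n : ℝ) - 1) * c / x) ^ (-(1 / 2) : ℝ)))) ^ 2

theorem hasDerivAt_alphaF (n : ℕ) (c x : ℝ) (h : x ^ 2 + 4 * ((n : ℝ) - 1) * c * x ≠ 0) :
    HasDerivAt (alphaF n c)
      ((n : ℝ) / (2 * ((n : ℝ) - 1)) - ((n : ℝ) - 2) / (2 * ((n : ℝ) - 1)) *
        ((x + 2 * ((n : ℝ) - 1) * c) / Real.sqrt (x ^ 2 + 4 * ((n : ℝ) - 1) * c * x))) x := by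
  have hpoly : HasDerivAt (fun y : ℝ => y ^ 2 + 4 * ((n : ℝ) - 1) * c * y)
      (2 * x + 4 * ((n : ℝ) - 1) * c) x := by
    simpa using (hasDerivAt_pow 2 x).fun_add ((hasDerivAt_id x).const_mul (4 * ((n : ℝ) - 1) * c))
  have hlin : HasDerivAt (fun y : ℝ => (n : ℝ) * c + (n : ℝ) / (2 * ((n : ℝ) - 1)) * y)
      ((n : ℝ) / (2 * ((n : ℝ) - 1))) x := by
    simpa using ((hasDerivAt_id x).const_mul ((n : ℝ) / (2 * ((n : ℝ) - 1)))).const_add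
      ((n : ℝ) * c)
  refine (hlin.fun_sub ((hpoly.sqrt h).const_mul
    (((n : ℝ) - 2) / (2 * ((n : ℝ) - 1))))).congr_deriv ?_
  rw [← mul_div_mul_left (x + 2 * ((n : ℝ) - 1) * c) _ (two_ne_zero' ℝ)]
  ring

theorem stmt_17 (n : ℕ) (hn : 3 ≤ n) (c : ℝ) (hc : 0 < c) (x : ℝ) (hx : 0 < x) :
    (alphaF n c x + (n : ℝ) * c) * x * deriv (alphaF n c) x =
      2 * c * x + (alphaF n c x) ^ 2 - (n : ℝ) * c * alphaF n c x := by
  have hn' : (3 : ℝ) ≤ n := by exact_mod_cast hn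
  have hm : 0 < (n : ℝ) - 1 := by linarith
  have hpos : 0 < x ^ 2 + 4 * ((n : ℝ) - 1) * c * x := by positivity
  rw [(hasDerivAt_alphaF n c x hpos.ne').deriv, alphaF]
  have hs := Real.sqrt_pos.2 hpos
  have hsq := Real.sq_sqrt hpos.le
  generalize Real.sqrt (x ^ 2 + 4 * ((n : ℝ) - 1) * c * x) = s at hs hsq ⊢
  have hs0 := hs.ne'
  have hm0 := hm.ne'
  field_simp
  grind
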